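/- arXiv:1608.04084 — 2 statements merged into one kernel-verified Lean document; each statement's English description precedes it below -/
import Mathlib

section
/- If M_t solves the complex Burgers equation ∂M_t/∂t = −2 M_t · ∂M_t/∂z and M_t has no zeros, then F_t := 1/M_t satisfies ∂F_t/∂t = −(2/F_t) · ∂F_t/∂z, and if V_t denotes a local inverse of F_t (i.e. F_t(V_t(z)) = z), then ∂V_t(z)/∂t = 2/z. Consequently V_t(z) = V_0(z) + 2t/z, so M_t is uniquely determined by M_0. -/
open Filter Topology in
/-- If a function of two real variables is constant on the diagonal of `S × S` and has both partial
derivatives at the points of the diagonal, then these add up to zero outside a countable set. No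
joint regularity is needed. -/
theorem countable_setOf_add_partial_deriv_ne_zero {E : Type*} [NormedAddCommGroup E]
    [NormedSpace ℝ E] [TopologicalSpace.SeparableSpace E] {S : Set ℝ} {h : ℝ → ℝ → E} {c : E}
    {a b : ℝ → E} (hdiag : ∀ t ∈ S, h t t = c)
    (ha : ∀ t ∈ S, HasDerivWithinAt (h t) (a t) S t)
    (hb : ∀ t ∈ S, HasDerivWithinAt (fun r => h r t) (b t) S t) :
    {t ∈ S | a t + b t ≠ 0}.Countable := by
  let q : ℕ → E := TopologicalSpace.denseSeq E
  let A : ℕ → ℕ → ℕ → Set ℝ := fun n m k => {s ∈ S | ‖b s - q m‖ ≤ 1 / (n + 1) ∧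
    ∀ r ∈ S, r ≠ s → dist r s < 1 / (k + 1) →
      ‖slope (fun r => h r s) s r - q m‖ ≤ 1 / (n + 1)}
  have hA : (⋃ n, ⋃ m, ⋃ k, {x ∈ A n m k | 𝓝[A n m k ∩ Set.Ioi x] x = ⊥}).Countable :=
    Set.countable_iUnion fun _ => Set.countable_iUnion fun _ => Set.countable_iUnion fun _ =>
      countable_setOfPred_isolated_right_within
  refine hA.mono ?_
  rintro t ⟨htS, hne⟩
  obtain ⟨n, hn⟩ := exists_nat_one_div_lt (half_pos (norm_pos_iff.2 hne))
  have hε : (0 : ℝ) < 1 / (n + 1) := Nat.one_div_pos_of_nat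
  obtain ⟨m, hm⟩ := (TopologicalSpace.denseRange_denseSeq E).exists_dist_lt (b t) (half_pos hε)
  have hm' : ‖b t - q m‖ < 1 / (n + 1) / 2 := by rwa [← dist_eq_norm]
  have hslope := hasDerivWithinAt_iff_tendsto_slope.1 (hb t htS)
  obtain ⟨δ, hδ, hball⟩ := Metric.mem_nhdsWithin_iff.1
    (hslope (Metric.ball_mem_nhds (b t) (half_pos hε)))
  obtain ⟨k, hk⟩ := exists_nat_one_div_lt hδ
  have htA : t ∈ A n m k := by
    refine ⟨htS, by linarith, fun r hr hrt hd => ?_⟩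
    have hr' : dist (slope (fun r => h r t) t r) (b t) < 1 / (n + 1) / 2 :=
      hball ⟨Metric.mem_ball.2 (hd.trans hk), hr, hrt⟩
    rw [← dist_eq_norm] at hm' ⊢
    linarith [dist_triangle (slope (fun r => h r t) t r) (b t) (q m)]
  simp only [Set.mem_iUnion]
  refine ⟨n, m, k, htA, ?_⟩
  by_contra hbot
  have : (𝓝[A n m k ∩ Set.Ioi t] t).NeBot := ⟨hbot⟩
  have hsub : A n m k ∩ Set.Ioi t ⊆ S \ {t} := fun s hs => ⟨hs.1.1, (ne_of_gt hs.2)⟩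
  have hlim := (((hasDerivWithinAt_iff_tendsto_slope.1 (ha t htS)).mono_left
    (nhdsWithin_mono t hsub)).add_const (q m)).norm
  have hclose : ‖a t + q m‖ ≤ 1 / (n + 1) := by
    refine le_of_tendsto hlim ?_
    filter_upwards [self_mem_nhdsWithin,
      mem_nhdsWithin_of_mem_nhds (Metric.ball_mem_nhds t (Nat.one_div_pos_of_nat (n := k)))]
      with s hs hst
    have hbound := hs.1.2.2 t htS (ne_of_lt hs.2) (by rwa [dist_comm])
    have hswap : slope (h t) t s = -slope (fun r => h r s) s t := by
      simp only [slope_def_module, hdiag t htS, hdiag s hs.1.1]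
      rw [← neg_sub s t, inv_neg, neg_smul, neg_neg]
    rwa [hswap, neg_add_eq_sub, norm_sub_rev]
  have htri : ‖a t + b t‖ ≤ ‖a t + q m‖ + ‖b t - q m‖ := by
    simpa using norm_add_le (a t + q m) (b t - q m)
  linarith

/-- If `M_t` solves the Burgers equation `∂M_t/∂t = −2 M_t ∂M_t/∂z` and is zero-free,
then `F_t = 1/M_t` satisfies `∂F_t/∂t = −(2/F_t) ∂F_t/∂z`; if `V_t` is a local inverse
of `F_t` (i.e. `F_t (V_t w) = w`), then `∂V_t(w)/∂t = 2/w`, hence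
`V_t(w) = V_0(w) + 2t/w`, so `M_t` is uniquely determined by `M_0`. -/
theorem stmt_7 (T : ℝ) (hT : 0 < T) (Γ Ω : Set ℂ) (hΓ : Γ ⊆ {z : ℂ | 0 < z.im})
    (M F V : ℝ → ℂ → ℂ)
    (hM0 : ∀ t ∈ Set.Icc (0 : ℝ) T, ∀ z ∈ Γ, M t z ≠ 0)
    (hMdiff : ∀ t ∈ Set.Icc (0 : ℝ) T, ∀ z ∈ Γ, DifferentiableAt ℂ (M t) z)
    (hburgers : ∀ t ∈ Set.Icc (0 : ℝ) T, ∀ z ∈ Γ,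
      HasDerivAt (fun s => M s z) (-2 * M t z * deriv (M t) z) t)
    (hF : ∀ t z, F t z = 1 / M t z)
    (hF' : ∀ t ∈ Set.Icc (0 : ℝ) T, ∀ z ∈ Γ, deriv (F t) z ≠ 0)
    (hV : ∀ t ∈ Set.Icc (0 : ℝ) T, ∀ w ∈ Ω, V t w ∈ Γ ∧ F t (V t w) = w)
    (hVdiff : ∀ w ∈ Ω, ∀ t ∈ Set.Icc (0 : ℝ) T,
      ∃ d : ℂ, HasDerivWithinAt (fun s => V s w) d (Set.Icc 0 T) t) :
    (∀ t ∈ Set.Icc (0 : ℝ) T, ∀ z ∈ Γ,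
      HasDerivAt (fun s => F s z) (-(2 / F t z) * deriv (F t) z) t) ∧
    (∀ t ∈ Set.Icc (0 : ℝ) T, ∀ w ∈ Ω,
      HasDerivWithinAt (fun s => V s w) (2 / w) (Set.Icc 0 T) t) ∧
    (∀ t ∈ Set.Icc (0 : ℝ) T, ∀ w ∈ Ω, V t w = V 0 w + 2 * t / w) := by
  have hFz : ∀ t ∈ Set.Icc (0 : ℝ) T, ∀ z ∈ Γ,
      HasDerivAt (F t) (-deriv (M t) z / M t z ^ 2) z := fun t ht z hz ↦ by
    have hFt : F t = (M t)⁻¹ := by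
      ext y
      simp [hF]
    rw [hFt]
    exact (hMdiff t ht z hz).hasDerivAt.inv (hM0 t ht z hz)
  have hFt : ∀ t ∈ Set.Icc (0 : ℝ) T, ∀ z ∈ Γ,
      HasDerivAt (fun s => F s z) (-(2 / F t z) * deriv (F t) z) t := fun t ht z hz ↦ by
    have hne := hM0 t ht z hz
    have hinv : (fun s => F s z) = (fun s => M s z)⁻¹ := by
      ext s
      simp [hF]
    rw [hinv, (hFz t ht z hz).deriv, hF]
    have hrate : -(2 / (1 / M t z)) * (-deriv (M t) z / M t z ^ 2) =
        -(-2 * M t z * deriv (M t) z) / M t z ^ 2 := by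
      field_simp
    rw [hrate]
    exact (hburgers t ht z hz).inv hne
  have hlin : ∀ t ∈ Set.Icc (0 : ℝ) T, ∀ w ∈ Ω, V t w = V 0 w + 2 * t / w := by
    intro t ht w hw
    choose! d hd using hVdiff w hw
    have hcount := countable_setOf_add_partial_deriv_ne_zero (S := Set.Icc 0 T)
      (h := fun r s => F r (V s w)) (c := w)
      (a := fun s => deriv (F s) (V s w) * d s)
      (b := fun s => -(2 / F s (V s w)) * deriv (F s) (V s w))
      (fun s hs => (hV s hs w hw).2)
      (fun s hs => by
        have hz := hFz s hs _ (hV s hs w hw).1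
        have hz' := hz.differentiableAt.hasDerivAt
        exact hz'.comp_hasDerivWithinAt s (hd s hs))
      (fun s hs => (hFt s hs _ (hV s hs w hw).1).hasDerivWithinAt)
    have hderiv : ∀ s ∈ Set.Icc (0 : ℝ) T,
        deriv (F s) (V s w) * d s + -(2 / F s (V s w)) * deriv (F s) (V s w) = 0 →
        d s = 2 / w := fun s hs h0 ↦ by
      obtain ⟨hVΓ, hFV⟩ := hV s hs w hw
      rw [hFV] at h0
      refine mul_left_cancel₀ (hF' s hs _ hVΓ) ?_
      linear_combination h0
    have hint := MeasureTheory.integral_eq_of_hasDerivAt_off_countable_of_le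
      (fun s => V s w) (fun _ => 2 / w) ht.1 hcount
      (fun s hs => ((hd s ⟨hs.1, hs.2.trans ht.2⟩).continuousWithinAt).mono
        (Set.Icc_subset_Icc_right ht.2))
      (fun s hs => by
        have hs' : s ∈ Set.Icc (0 : ℝ) T := ⟨hs.1.1.le, hs.1.2.le.trans ht.2⟩
        rw [← hderiv s hs' (by_contra fun hne => hs.2 ⟨hs', hne⟩)]
        exact (hd s hs').hasDerivAt (Icc_mem_nhds hs.1.1 (hs.1.2.trans_le ht.2)))
      intervalIntegrable_const
    rw [intervalIntegral.integral_const, sub_zero, Complex.real_smul] at hint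
    linear_combination -hint
  refine ⟨hFt, fun t ht w hw => ?_, hlin⟩
  have hline : HasDerivAt (fun s : ℝ => V 0 w + 2 * (s : ℂ) / w) (2 / w) t := by
    simpa using (((hasDerivAt_id t).ofReal_comp.const_mul (2 : ℂ)).div_const w).const_add (V 0 w)
  exact hline.hasDerivWithinAt.congr (fun s hs => hlin s hs w hw) (hlin t ht w hw)
end

section
/- For the half-plane capacity characteristic calculation: if g : ℍ∖A → ℍ is conformal with hydrodynamic expansion g(z) = z + b/z + o(1/z) as z → ∞ and A ⊂ A′ are two bounded hulls with maps g_A, g_{A′} and capacities b, b′, then hcap is additive under composition: hcap(A′) = hcap(A) + hcap(g_A(A′ ∖ A)); in particular hcap is monotone: A ⊂ A′ implies hcap(A) ≤ hcap(A′). -/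
open Bornology Filter

open Topology ComplexConjugate

/-- A left inverse of an injective holomorphic function on an open set is holomorphic on
the image. -/
theorem differentiableAt_leftInvOn_of_injective {f k : ℂ → ℂ} {U : Set ℂ} (hU : IsOpen U)
    (hf : DifferentiableOn ℂ f U) (hk : Set.LeftInvOn k f U) {z₀ : ℂ} (hz₀ : z₀ ∈ U) :
    DifferentiableAt ℂ k (f z₀) := by
  have han : ∀ z ∈ U, AnalyticAt ℂ f z := fun z hz => hf.analyticAt (hU.mem_nhds hz)
  have hnc : ∀ z ∈ U, ¬ ∀ᶠ w in 𝓝 z, f w = f z := by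
    intro z hz h
    have h1 : ∀ᶠ w in 𝓝 z, w = z := by
      filter_upwards [h, hU.mem_nhds hz] with w hw hwU
      exact hk.injOn hwU hz hw
    have h2 : ∀ᶠ w in 𝓝[≠] z, w = z := h1.filter_mono nhdsWithin_le_nhds
    obtain ⟨w, hw, hw'⟩ := (h2.and self_mem_nhdsWithin).exists
    exact hw' hw
  have hopen : ∀ z ∈ U, 𝓝 (f z) ≤ map f (𝓝 z) := fun z hz =>
    ((han z hz).eventually_constant_or_nhds_le_map_nhds).resolve_left (hnc z hz)
  have hcont : ∀ z ∈ U, ContinuousAt k (f z) := by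
    intro z hz
    have h1 : Tendsto (k ∘ f) (𝓝 z) (𝓝 z) :=
      tendsto_id.congr' (by
        filter_upwards [hU.mem_nhds hz] with w hw
        exact (hk hw).symm)
    have h2 : Tendsto k (map f (𝓝 z)) (𝓝 z) := h1
    have h3 := h2.mono_left (hopen z hz)
    rwa [ContinuousAt, hk hz]
  have hright : ∀ z ∈ U, ∀ᶠ w in 𝓝 (f z), f (k w) = w ∧ k w ∈ U := by
    intro z hz
    refine hopen z hz ?_
    change ∀ᶠ w in map f (𝓝 z), f (k w) = w ∧ k w ∈ U
    rw [eventually_map]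
    filter_upwards [hU.mem_nhds hz] with w hw
    rw [hk hw]
    exact ⟨rfl, hw⟩
  have hreg : ∀ z ∈ U, deriv f z ≠ 0 → DifferentiableAt ℂ k (f z) := by
    intro z hz hd
    refine (HasDerivAt.of_local_left_inverse (f := f) (f' := deriv f z) (hcont z hz) ?_ hd
      ?_).differentiableAt
    · rw [hk hz]
      exact (han z hz).differentiableAt.hasDerivAt
    · exact (hright z hz).mono fun w hw => hw.1
  have hne : ∀ᶠ z in 𝓝[≠] z₀, deriv f z ≠ 0 := by
    refine ((han z₀ hz₀).deriv.eventually_eq_zero_or_eventually_ne_zero).resolve_left ?_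
    intro h0
    obtain ⟨r, hr, hball⟩ := Metric.eventually_nhds_iff_ball.1 (h0.and (hU.mem_nhds hz₀))
    refine hnc z₀ hz₀ ?_
    filter_upwards [Metric.ball_mem_nhds z₀ hr] with w hw
    exact Metric.isOpen_ball.is_const_of_deriv_eq_zero (convex_ball z₀ r).isPreconnected
      (hf.mono fun y hy => (hball y hy).2) (fun y hy => (hball y hy).1) hw
      (Metric.mem_ball_self hr)
  have htend : Tendsto k (𝓝[≠] (f z₀)) (𝓝[≠] z₀) := by
    refine tendsto_nhdsWithin_iff.2 ⟨?_, ?_⟩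
    · have h := hcont z₀ hz₀
      rw [ContinuousAt, hk hz₀] at h
      exact h.mono_left nhdsWithin_le_nhds
    · filter_upwards [(hright z₀ hz₀).filter_mono nhdsWithin_le_nhds, self_mem_nhdsWithin]
        with w hw hw' h
      rw [Set.mem_singleton_iff] at h
      rw [h] at hw
      exact hw' hw.1.symm
  refine (Complex.analyticAt_of_differentiable_on_punctured_nhds_of_continuousAt ?_
    (hcont z₀ hz₀)).differentiableAt
  filter_upwards [htend.eventually hne, (hright z₀ hz₀).filter_mono nhdsWithin_le_nhds]
    with w hw hw'
  have := hreg (k w) hw'.2 hw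
  rwa [hw'.1] at this

theorem normSq_sub_conj (a b : ℂ) :
    Complex.normSq (a - conj b) = Complex.normSq (a - b) + 4 * (a.im * b.im) := by
  simp only [Complex.normSq_apply, Complex.sub_re, Complex.sub_im, Complex.conj_re,
    Complex.conj_im]
  ring

theorem sub_conj_ne_zero {a b : ℂ} (ha : 0 < a.im) (hb : 0 < b.im) : a - conj b ≠ 0 := by
  intro h
  have := congrArg Complex.im h
  simp only [Complex.sub_im, Complex.conj_im, Complex.zero_im] at this
  linarith

theorem norm_sub_div_sub_conj_lt_one {a b : ℂ} (ha : 0 < a.im) (hb : 0 < b.im) :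
    ‖(a - b) / (a - conj b)‖ < 1 := by
  rw [norm_div, div_lt_one (norm_pos_iff.2 (sub_conj_ne_zero ha hb))]
  refine lt_of_pow_lt_pow_left₀ 2 (norm_nonneg _) ?_
  rw [← Complex.normSq_eq_norm_sq, ← Complex.normSq_eq_norm_sq, normSq_sub_conj]
  nlinarith [mul_pos ha hb]

/-- The **Schwarz-Pick lemma** for holomorphic self-maps of the upper half-plane. -/
theorem schwarz_pick_upperHalfPlane {φ : ℂ → ℂ} (hφ : DifferentiableOn ℂ φ {z | 0 < z.im})
    (hmaps : Set.MapsTo φ {z | 0 < z.im} {z | 0 < z.im}) {v w : ℂ} (hv : 0 < v.im)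
    (hw : 0 < w.im) :
    Complex.normSq (φ w - φ v) * (w.im * v.im) ≤
      Complex.normSq (w - v) * ((φ w).im * (φ v).im) := by
  set T : ℂ → ℂ := fun ζ => (v - conj v * ζ) / (1 - ζ) with hT
  set F : ℂ → ℂ := fun ζ => (φ (T ζ) - φ v) / (φ (T ζ) - conj (φ v)) with hF
  have hball : ∀ ζ ∈ Metric.ball (0 : ℂ) 1, 1 - ζ ≠ 0 := by
    intro ζ hζ h
    rw [mem_ball_zero_iff, ← sub_eq_zero.1 h] at hζ
    simp at hζ
  have hTim : ∀ ζ ∈ Metric.ball (0 : ℂ) 1, 0 < (T ζ).im := by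
    intro ζ hζ
    have h1 := hball ζ hζ
    have hn : Complex.normSq ζ < 1 := by
      rw [mem_ball_zero_iff] at hζ
      rw [Complex.normSq_eq_norm_sq]
      nlinarith [norm_nonneg ζ]
    have hpos : 0 < Complex.normSq (1 - ζ) := Complex.normSq_pos.2 h1
    have : (T ζ).im = v.im * (1 - Complex.normSq ζ) / Complex.normSq (1 - ζ) := by
      simp only [hT, Complex.div_im]
      field_simp
      simp only [Complex.normSq_apply, Complex.sub_re, Complex.sub_im, Complex.mul_re,
        Complex.mul_im, Complex.conj_re, Complex.conj_im, Complex.one_re, Complex.one_im]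
      ring
    rw [this]
    exact div_pos (mul_pos hv (by linarith)) hpos
  have hTdiff : DifferentiableOn ℂ T (Metric.ball 0 1) :=
    DifferentiableOn.div (by fun_prop) (by fun_prop) hball
  have hcomp : DifferentiableOn ℂ (fun ζ => φ (T ζ)) (Metric.ball 0 1) := hφ.comp hTdiff hTim
  have hFdiff : DifferentiableOn ℂ F (Metric.ball 0 1) :=
    (hcomp.sub_const _).div (hcomp.sub_const _) fun ζ hζ =>
      sub_conj_ne_zero (hmaps (hTim ζ hζ)) (hmaps hv)
  have hFmaps : Set.MapsTo F (Metric.ball 0 1) (Metric.closedBall 0 1) := fun ζ hζ =>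
    mem_closedBall_zero_iff.2 (norm_sub_div_sub_conj_lt_one (hmaps (hTim ζ hζ)) (hmaps hv)).le
  have hF0 : F 0 = 0 := by simp [hF, hT]
  have hwv := sub_conj_ne_zero hw hv
  have hvv := sub_conj_ne_zero hv hv
  have hTw : T ((w - v) / (w - conj v)) = w := by
    have h1 : 1 - (w - v) / (w - conj v) ≠ 0 := by
      rw [one_sub_div hwv]
      refine div_ne_zero ?_ hwv
      rwa [sub_sub_sub_cancel_left]
    simp only [hT]
    rw [div_eq_iff h1]
    field_simp
    ring
  have key := Complex.norm_le_norm_of_mapsTo_ball hFdiff hFmaps hF0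
    (norm_sub_div_sub_conj_lt_one hw hv)
  simp only [hF, hTw] at key
  have hφwv := sub_conj_ne_zero (hmaps hw) (hmaps hv)
  rw [norm_div, norm_div, div_le_div_iff₀ (norm_pos_iff.2 hφwv) (norm_pos_iff.2 hwv)] at key
  have key2 := pow_le_pow_left₀ (by positivity) key 2
  rw [mul_pow, mul_pow, ← Complex.normSq_eq_norm_sq, ← Complex.normSq_eq_norm_sq,
    ← Complex.normSq_eq_norm_sq, ← Complex.normSq_eq_norm_sq, normSq_sub_conj,
    normSq_sub_conj] at key2
  linarith

/-- Two conformal bijections of the same open set onto the upper half-plane induce the same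
hyperbolic metric. -/
theorem normSq_sub_mul_im_le_of_bijOn {U : Set ℂ} (hU : IsOpen U) {f g : ℂ → ℂ}
    (hf : Set.BijOn f U {z | 0 < z.im}) (hfd : DifferentiableOn ℂ f U)
    (hg : Set.MapsTo g U {z | 0 < z.im}) (hgd : DifferentiableOn ℂ g U) {p q : ℂ}
    (hp : p ∈ U) (hq : q ∈ U) :
    Complex.normSq (g q - g p) * ((f q).im * (f p).im) ≤
      Complex.normSq (f q - f p) * ((g q).im * (g p).im) := by
  have hinv := hf.invOn_invFunOn
  set k := Function.invFunOn f U with hk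
  have hkmaps : Set.MapsTo k {z | 0 < z.im} U := hf.surjOn.mapsTo_invFunOn
  have hkd : DifferentiableOn ℂ k {z | 0 < z.im} := by
    intro w hw
    have := differentiableAt_leftInvOn_of_injective hU hfd hinv.1 (hkmaps hw)
    rw [hinv.2 hw] at this
    exact this.differentiableWithinAt
  have := schwarz_pick_upperHalfPlane (hgd.comp hkd hkmaps) (hg.comp hkmaps)
    (hf.mapsTo hp) (hf.mapsTo hq)
  simpa only [Function.comp_apply, hinv.1 hp, hinv.1 hq] using this

theorem tendsto_vertical_cobounded (x : ℝ) :
    Tendsto (fun y : ℝ => (x : ℂ) + y * Complex.I) atTop (cobounded ℂ) := by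
  rw [← tendsto_norm_atTop_iff_cobounded]
  refine tendsto_atTop_mono (fun y => ?_) tendsto_id
  have h := Complex.abs_im_le_norm ((x : ℂ) + y * Complex.I)
  simp only [Complex.add_im, Complex.ofReal_im, Complex.mul_im, Complex.ofReal_re,
    Complex.I_im, Complex.I_re, mul_one, mul_zero, add_zero, zero_add] at h
  exact (le_abs_self y).trans h

theorem tendsto_vertical {A : Set ℂ} (hA : IsBounded A) (x : ℝ) :
    Tendsto (fun y : ℝ => (x : ℂ) + y * Complex.I) atTop
      (cobounded ℂ ⊓ 𝓟 ({z : ℂ | 0 < z.im} \ A)) := by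
  refine tendsto_inf.2 ⟨tendsto_vertical_cobounded x, tendsto_principal.2 ?_⟩
  have h1 : ∀ᶠ z in cobounded ℂ, z ∉ A := isBounded_def.1 hA
  filter_upwards [(tendsto_vertical_cobounded x).eventually h1, eventually_gt_atTop 0]
    with y hy hy0
  exact ⟨by simpa using hy0, hy⟩

theorem tendsto_sub_of_tendsto_mul_sub {l : Filter ℂ} (hl : l ≤ cobounded ℂ) {f : ℂ → ℂ}
    {c : ℂ} (h : Tendsto (fun z => z * (f z - z)) l (𝓝 c)) :
    Tendsto (fun z => f z - z) l (𝓝 0) := by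
  have h1 : Tendsto (fun z : ℂ => z⁻¹) l (𝓝 0) := tendsto_inv₀_cobounded.mono_left hl
  have h2 := h1.mul h
  rw [zero_mul] at h2
  refine h2.congr' ?_
  filter_upwards [hl (eventually_ne_cobounded (0 : ℂ))] with z hz
  field_simp

theorem tendsto_vertical_div {f : ℂ → ℂ} {x : ℝ}
    (hf : Tendsto (fun y : ℝ => f (x + y * Complex.I) - (x + y * Complex.I)) atTop (𝓝 0))
    (c : ℂ) :
    Tendsto (fun y : ℝ => (f (x + y * Complex.I) - c) / y) atTop (𝓝 Complex.I) := by
  have h1 : Tendsto (fun y : ℝ => ((y : ℂ))⁻¹) atTop (𝓝 0) :=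
    tendsto_inv₀_cobounded.comp (RCLike.tendsto_ofReal_atTop_cobounded ℂ)
  have h2 := ((hf.add_const ((x : ℂ) - c)).mul h1).add_const Complex.I
  rw [mul_zero, zero_add] at h2
  refine h2.congr' ?_
  filter_upwards [eventually_ne_atTop 0] with y hy
  have : (y : ℂ) ≠ 0 := by exact_mod_cast hy
  field_simp
  ring

/-- Uniqueness of the hydrodynamically normalized conformal map. -/
theorem eqOn_of_bijOn_upperHalfPlane_of_tendsto_sub {A : Set ℂ} (hA : IsBounded A)
    (hopen : IsOpen ({z : ℂ | 0 < z.im} \ A)) {f g : ℂ → ℂ}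
    (hf : Set.BijOn f ({z : ℂ | 0 < z.im} \ A) {z | 0 < z.im})
    (hfd : DifferentiableOn ℂ f ({z : ℂ | 0 < z.im} \ A))
    (hg : Set.BijOn g ({z : ℂ | 0 < z.im} \ A) {z | 0 < z.im})
    (hgd : DifferentiableOn ℂ g ({z : ℂ | 0 < z.im} \ A))
    (hf0 : Tendsto (fun z => f z - z) (cobounded ℂ ⊓ 𝓟 ({z : ℂ | 0 < z.im} \ A)) (𝓝 0))
    (hg0 : Tendsto (fun z => g z - z) (cobounded ℂ ⊓ 𝓟 ({z : ℂ | 0 < z.im} \ A)) (𝓝 0)) :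
    Set.EqOn f g ({z : ℂ | 0 < z.im} \ A) := by
  set U := {z : ℂ | 0 < z.im} \ A with hU
  have hdist : ∀ p ∈ U, ∀ q ∈ U, Complex.normSq (g q - g p) * ((f q).im * (f p).im) =
      Complex.normSq (f q - f p) * ((g q).im * (g p).im) := fun p hp q hq =>
    le_antisymm (normSq_sub_mul_im_le_of_bijOn hopen hf hfd hg.mapsTo hgd hp hq)
      (normSq_sub_mul_im_le_of_bijOn hopen hg hgd hf.mapsTo hfd hp hq)
  have hmem : ∀ x : ℝ, ∀ᶠ y : ℝ in atTop, (x : ℂ) + y * Complex.I ∈ U := fun x =>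
    tendsto_principal.1 (tendsto_inf.1 (tendsto_vertical hA x)).2
  have him : ∀ p ∈ U, (f p).im = (g p).im := by
    intro p hp
    have hf1 := hf0.comp (tendsto_vertical hA 0)
    have hg1 := hg0.comp (tendsto_vertical hA 0)
    have hL := ((Complex.continuous_normSq.tendsto _).comp (tendsto_vertical_div hg1 (g p))).mul
      (((Complex.continuous_im.tendsto _).comp (tendsto_vertical_div hf1 0)).mul_const (f p).im)
    have hR := ((Complex.continuous_normSq.tendsto _).comp (tendsto_vertical_div hf1 (f p))).mul
      (((Complex.continuous_im.tendsto _).comp (tendsto_vertical_div hg1 0)).mul_const (g p).im)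
    have h := tendsto_nhds_unique (hL.congr' ?_) hR
    · simpa using h
    · filter_upwards [hmem 0] with y hy
      have h := hdist p hp _ hy
      simp only [Function.comp_apply, sub_zero, Complex.normSq_div, Complex.div_ofReal_im]
      linear_combination (Complex.normSq (y : ℂ))⁻¹ * y⁻¹ * h
  intro p hp
  refine Complex.ext ?_ (him p hp)
  set x := (f p).re with hx
  have hf1 := hf0.comp (tendsto_vertical hA x)
  have hg1 := hg0.comp (tendsto_vertical hA x)
  have hre : ∀ {h : ℂ → ℂ}, Tendsto ((fun z => h z - z) ∘ fun y : ℝ => (x : ℂ) + y * Complex.I)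
      atTop (𝓝 0) → Tendsto (fun y : ℝ => (h (x + y * Complex.I)).re) atTop (𝓝 x) := by
    intro h hh
    have := ((Complex.continuous_re.tendsto _).comp hh).add_const x
    simpa using this
  have hL := ((hre hg1).sub_const (g p).re).pow 2
  have hR := ((hre hf1).sub_const (f p).re).pow 2
  have h := tendsto_nhds_unique (hL.congr' ?_) hR
  · rw [← hx, sub_self, zero_pow two_ne_zero] at h
    exact sub_eq_zero.1 (pow_eq_zero_iff two_ne_zero |>.1 h)
  · filter_upwards [hmem x] with y hy
    have h := hdist p hp _ hy
    have hpos : 0 < (f (x + y * Complex.I)).im * (f p).im :=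
      mul_pos (hf.mapsTo hy) (hf.mapsTo hp)
    rw [← him _ hy, ← him _ hp] at h
    have h := mul_right_cancel₀ hpos.ne' h
    rw [Complex.normSq_apply, Complex.normSq_apply] at h
    simp only [Complex.sub_re, Complex.sub_im, ← him _ hy, ← him _ hp] at h
    linear_combination h

/-- Additivity of half-plane capacity under composition: if `A ⊆ A'` are bounded
hulls with hydrodynamically normalized conformal maps `gA : ℍ∖A → ℍ`,
`gA' : ℍ∖A' → ℍ` of capacities `b, b'`, and `g₂` is the normalized map of the hull
`gA(A'∖A)` with capacity `b₂`, then `b' = b + b₂`; in particular `hcap` is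
monotone: `b ≤ b'`. (The expansion `g(z) = z + b/z + o(1/z)` is expressed as
`z(g(z) − z) → b` at infinity within the domain.) -/
theorem stmt_18 (H : Set ℂ) (hH : H = {z : ℂ | 0 < z.im})
    (A A' : Set ℂ) (hAA' : A ⊆ A')
    (hA : A ⊆ H) (hA' : A' ⊆ H)
    (hAbd : IsBounded A) (hA'bd : IsBounded A')
    (hAhull : closure A ∩ H = A) (hA'hull : closure A' ∩ H = A')
    (gA gA' g₂ : ℂ → ℂ) (b b' b₂ : ℝ)
    (hb : 0 ≤ b) (hb' : 0 ≤ b') (hb₂ : 0 ≤ b₂)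
    (hgA : Set.BijOn gA (H \ A) H) (hgA'hol : DifferentiableOn ℂ gA (H \ A))
    (hgA' : Set.BijOn gA' (H \ A') H) (hgA''hol : DifferentiableOn ℂ gA' (H \ A'))
    (hg₂ : Set.BijOn g₂ (H \ gA '' (A' \ A)) H)
    (hg₂hol : DifferentiableOn ℂ g₂ (H \ gA '' (A' \ A)))
    (hexpA : Tendsto (fun z => z * (gA z - z))
      (cobounded ℂ ⊓ principal (H \ A)) (nhds (b : ℂ)))
    (hexpA' : Tendsto (fun z => z * (gA' z - z))
      (cobounded ℂ ⊓ principal (H \ A')) (nhds (b' : ℂ)))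
    (hexp₂ : Tendsto (fun z => z * (g₂ z - z))
      (cobounded ℂ ⊓ principal (H \ gA '' (A' \ A))) (nhds (b₂ : ℂ))) :
    b' = b + b₂ ∧ b ≤ b' := by
  subst hH
  have hopen : ∀ B : Set ℂ, closure B ∩ {z : ℂ | 0 < z.im} = B →
      IsOpen ({z : ℂ | 0 < z.im} \ B) := by
    intro B hB
    rw [← hB, Set.sdiff_inter_self_eq_sdiff]
    exact (isOpen_lt continuous_const Complex.continuous_im).sdiff isClosed_closure
  have hsub : {z : ℂ | 0 < z.im} \ A' ⊆ {z : ℂ | 0 < z.im} \ A :=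
    Set.sdiff_subset_sdiff_right hAA'
  have himage : gA '' ({z : ℂ | 0 < z.im} \ A') = {z : ℂ | 0 < z.im} \ gA '' (A' \ A) := by
    have hunion : {z : ℂ | 0 < z.im} \ A' = ({z : ℂ | 0 < z.im} \ A) \ (A' \ A) := by
      ext z
      have := @hAA' z
      simp only [Set.mem_sdiff]
      tauto
    rw [hunion, Set.image_sdiff_of_injOn, hgA.image_eq]
    · exact hgA.injOn
    · exact Set.sdiff_subset_sdiff_left hA'
  have hbij : Set.BijOn (g₂ ∘ gA) ({z : ℂ | 0 < z.im} \ A') {z : ℂ | 0 < z.im} := by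
    refine hg₂.comp ?_
    rw [← himage]
    exact (hgA.injOn.mono hsub).bijOn_image
  have hmapsA : Set.MapsTo gA ({z : ℂ | 0 < z.im} \ A')
      ({z : ℂ | 0 < z.im} \ gA '' (A' \ A)) := by
    rw [← himage]
    exact Set.mapsTo_image _ _
  have hle : cobounded ℂ ⊓ 𝓟 ({z : ℂ | 0 < z.im} \ A') ≤
      cobounded ℂ ⊓ 𝓟 ({z : ℂ | 0 < z.im} \ A) :=
    inf_le_inf_left _ (principal_mono.2 hsub)
  have hA0 := tendsto_sub_of_tendsto_mul_sub inf_le_left (hexpA.mono_left hle)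
  have hgAinf : Tendsto gA (cobounded ℂ ⊓ 𝓟 ({z : ℂ | 0 < z.im} \ A'))
      (cobounded ℂ ⊓ 𝓟 ({z : ℂ | 0 < z.im} \ gA '' (A' \ A))) := by
    refine tendsto_inf.2 ⟨?_, ?_⟩
    · rw [← tendsto_norm_atTop_iff_cobounded]
      have hn : Tendsto (fun z : ℂ => ‖z‖) (cobounded ℂ ⊓ 𝓟 ({z : ℂ | 0 < z.im} \ A')) atTop :=
        tendsto_norm_cobounded_atTop.mono_left inf_le_left
      refine tendsto_atTop_mono (fun z => ?_) (hn.atTop_add hA0.norm.neg)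
      have h := norm_sub_norm_le z (z - gA z)
      rw [sub_sub_cancel, norm_sub_rev] at h
      linarith
    · exact tendsto_principal_principal.2 (fun z hz => hmapsA hz) |>.mono_left inf_le_right
  have hone : Tendsto (fun z => z / gA z) (cobounded ℂ ⊓ 𝓟 ({z : ℂ | 0 < z.im} \ A')) (𝓝 1) := by
    have h1 := tendsto_inv₀_cobounded.comp (tendsto_inf.1 hgAinf).1
    have h2 := (h1.mul hA0).const_sub 1
    rw [zero_mul, sub_zero] at h2
    refine h2.congr' ?_
    filter_upwards [(tendsto_inf.1 hgAinf).1.eventually (eventually_ne_cobounded (0 : ℂ))]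
      with z hz
    simp only [Function.comp_apply]
    field_simp
    ring
  have hcomp : Tendsto (fun z => z * ((g₂ ∘ gA) z - z))
      (cobounded ℂ ⊓ 𝓟 ({z : ℂ | 0 < z.im} \ A')) (𝓝 ((b : ℂ) + b₂)) := by
    have h := (hexpA.mono_left hle).add (hone.mul (hexp₂.comp hgAinf))
    rw [one_mul] at h
    refine h.congr' ?_
    filter_upwards [(tendsto_inf.1 hgAinf).1.eventually (eventually_ne_cobounded (0 : ℂ))]
      with z hz
    simp only [Function.comp_apply]
    field_simp
    ring
  have heq := eqOn_of_bijOn_upperHalfPlane_of_tendsto_sub hA'bd (hopen A' hA'hull) hgA' hgA''hol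
    hbij (hg₂hol.comp (hgA'hol.mono hsub) hmapsA)
    (tendsto_sub_of_tendsto_mul_sub inf_le_left hexpA')
    (tendsto_sub_of_tendsto_mul_sub inf_le_left hcomp)
  have hne : (cobounded ℂ ⊓ 𝓟 ({z : ℂ | 0 < z.im} \ A')).NeBot := (tendsto_vertical hA'bd 0).neBot
  have hadd : (b' : ℂ) = b + b₂ := by
    refine tendsto_nhds_unique hexpA' (hcomp.congr' ?_)
    filter_upwards [mem_inf_of_right (mem_principal_self _)] with z hz
    rw [heq hz]
  have hadd' : b' = b + b₂ := by exact_mod_cast hadd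
  exact ⟨hadd', by linarith⟩
end
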